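/- Let η : ℝⁿ → ℝ be convex and Lipschitz continuous with constant L_η, let ε > 0, and let u : ℝ → ℝⁿ be integrable and of bounded variation. Let P_ε u denote the cell-average projection of u on the grid of mesh ε. Then for every nonnegative continuously differentiable compactly supported φ : ℝ → ℝ, ∫_ℝ ( η(u(x)) − η(P_ε u(x)) ) φ(x) dx ≥ − L_η · ε² ‖φ'‖_{L∞} · Tot.Var.{u}. -/

import Mathlib

open Set MeasureTheory intervalIntegral
open scoped NNReal

/-- The cell-average projection on the grid of mesh `ε`:
`P_ε u (x) = ε⁻¹ ∫_{jε}^{(j+1)ε} u(y) dy` for `x ∈ [jε, (j+1)ε)`. -/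
noncomputable def cellAvg {n : ℕ} (ε : ℝ) (u : ℝ → EuclideanSpace ℝ (Fin n)) (x : ℝ) :
    EuclideanSpace ℝ (Fin n) :=
  ε⁻¹ • ∫ y in ((⌊x / ε⌋ : ℝ) * ε)..(((⌊x / ε⌋ : ℝ) + 1) * ε), u y

section CellEstimates

variable {E : Type*} [NormedAddCommGroup E] {a b : ℝ} {u : ℝ → E}

/-- Each value of a function of bounded variation on an interval is within its total variation
of its mean. -/
theorem norm_sub_mean_le_eVariationOn [NormedSpace ℝ E] [CompleteSpace E] (hab : a < b)
    (hu : IntervalIntegrable u volume a b) (hBV : BoundedVariationOn u (Icc a b)) {x : ℝ}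
    (hx : x ∈ Icc a b) :
    ‖u x - (b - a)⁻¹ • ∫ y in a..b, u y‖ ≤ (eVariationOn u (Icc a b)).toReal := by
  have hba : 0 < b - a := sub_pos.2 hab
  have hmean : u x - (b - a)⁻¹ • ∫ y in a..b, u y = (b - a)⁻¹ • ∫ y in a..b, (u x - u y) := by
    rw [intervalIntegral.integral_sub intervalIntegrable_const hu,
      intervalIntegral.integral_const, smul_sub, smul_smul, inv_mul_cancel₀ hba.ne', one_smul]
  have hint : ‖∫ y in a..b, (u x - u y)‖ ≤ (eVariationOn u (Icc a b)).toReal * |b - a| := by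
    refine intervalIntegral.norm_integral_le_of_norm_le_const fun y hy => ?_
    rw [uIoc_of_le hab.le] at hy
    rw [← dist_eq_norm]
    exact hBV.dist_le hx (Ioc_subset_Icc_self hy)
  rw [abs_of_pos hba] at hint
  rw [hmean, norm_smul, norm_inv, Real.norm_of_nonneg hba.le, inv_mul_le_iff₀ hba]
  linarith

theorem LipschitzWith.intervalIntegrable_comp_sub_const {η : E → ℝ} {K : ℝ≥0}
    (hη : LipschitzWith K η) (hu : IntervalIntegrable u volume a b) (m : E) :
    IntervalIntegrable (fun x => η (u x) - η m) volume a b := by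
  have hbound : IntervalIntegrable (fun x => (K : ℝ) * ‖u x - m‖) volume a b :=
    (hu.sub intervalIntegrable_const).norm.const_mul _
  refine hbound.mono_fun ?_ (Filter.Eventually.of_forall fun x => ?_)
  · exact (hη.continuous.comp_aestronglyMeasurable hu.def'.aestronglyMeasurable).sub
      aestronglyMeasurable_const
  · refine (hη.norm_sub_le _ _).trans (le_abs_self _)

/-- Jensen's inequality for the mean over an interval. -/
theorem ConvexOn.integral_comp_sub_mean_nonneg [NormedSpace ℝ E] [CompleteSpace E]
    {η : E → ℝ} {K : ℝ≥0}
    (hconv : ConvexOn ℝ univ η) (hη : LipschitzWith K η) (hab : a < b)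
    (hu : IntervalIntegrable u volume a b) :
    0 ≤ ∫ x in a..b, (η (u x) - η ((b - a)⁻¹ • ∫ y in a..b, u y)) := by
  have hba : 0 < b - a := sub_pos.2 hab
  have hηu : IntervalIntegrable (fun x => η (u x)) volume a b := by
    simpa using (hη.intervalIntegrable_comp_sub_const hu 0).add
      (intervalIntegrable_const (c := η 0))
  have hJ : η (⨍ x in a..b, u x) ≤ ⨍ x in a..b, η (u x) := by
    refine hconv.map_set_average_le hη.continuous.continuousOn isClosed_univ ?_ ?_ (by simp)
      hu.def' hηu.def'
    · simpa [uIoc_of_le hab.le] using hab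
    · simp [uIoc_of_le hab.le]
  rw [interval_average_eq, interval_average_eq, smul_eq_mul, le_inv_mul_iff₀ hba] at hJ
  rw [intervalIntegral.integral_sub hηu intervalIntegrable_const, intervalIntegral.integral_const,
    smul_eq_mul]
  linarith

/-- The entropy estimate on a single cell. -/
theorem ConvexOn.neg_le_integral_comp_sub_mean_mul [NormedSpace ℝ E] [CompleteSpace E]
    {η : E → ℝ} {K : ℝ≥0}
    (hconv : ConvexOn ℝ univ η) (hη : LipschitzWith K η) (hab : a < b)
    (hu : IntervalIntegrable u volume a b) (hBV : BoundedVariationOn u (Icc a b))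
    {φ : ℝ → ℝ} (hφ : Differentiable ℝ φ) (hpos : 0 ≤ φ a) {N : ℝ} (hN : ∀ x, |deriv φ x| ≤ N) :
    -(K * (b - a) ^ 2 * N * (eVariationOn u (Icc a b)).toReal) ≤
      ∫ x in a..b, (η (u x) - η ((b - a)⁻¹ • ∫ y in a..b, u y)) * φ x := by
  set m := (b - a)⁻¹ • ∫ y in a..b, u y with hm
  set V := (eVariationOn u (Icc a b)).toReal
  have hba : 0 < b - a := sub_pos.2 hab
  have hN0 : 0 ≤ N := (abs_nonneg _).trans (hN 0)
  have hf : IntervalIntegrable (fun x => η (u x) - η m) volume a b :=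
    hη.intervalIntegrable_comp_sub_const hu m
  have hpt : ∀ x ∈ Icc a b, (η (u x) - η m) * φ a - K * V * (N * (b - a)) ≤
      (η (u x) - η m) * φ x := by
    intro x hx
    have hηx : |η (u x) - η m| ≤ K * V := (hη.norm_sub_le _ _).trans <|
      mul_le_mul_of_nonneg_left (norm_sub_mean_le_eVariationOn hab hu hBV hx) K.2
    have hφx : |φ x - φ a| ≤ N * (b - a) := by
      have h := Convex.norm_image_sub_le_of_norm_deriv_le (s := univ) (x := a) (y := x)
        (fun y _ => hφ y) (fun y _ => hN y) convex_univ (mem_univ _) (mem_univ _)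
      refine h.trans (mul_le_mul_of_nonneg_left ?_ hN0)
      rw [Real.norm_of_nonneg (sub_nonneg.2 hx.1)]
      linarith [hx.2]
    have hprod : |(η (u x) - η m) * (φ x - φ a)| ≤ K * V * (N * (b - a)) := by
      rw [abs_mul]
      exact mul_le_mul hηx hφx (abs_nonneg _) ((abs_nonneg _).trans hηx)
    linarith [neg_abs_le ((η (u x) - η m) * (φ x - φ a)),
      mul_sub (η (u x) - η m) (φ x) (φ a)]
  have hmono := intervalIntegral.integral_mono_on hab.le
    ((hf.mul_const (φ a)).sub intervalIntegrable_const)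
    (hf.mul_continuousOn hφ.continuous.continuousOn) hpt
  rw [intervalIntegral.integral_sub (hf.mul_const (φ a)) intervalIntegrable_const,
    intervalIntegral.integral_mul_const, intervalIntegral.integral_const, smul_eq_mul] at hmono
  have hJ := mul_nonneg (hconv.integral_comp_sub_mean_nonneg hη hab hu) hpos
  rw [← hm] at hJ
  linarith

end CellEstimates

theorem cellAvg_eq_of_mem_Ico {n : ℕ} {ε : ℝ} (hε : 0 < ε) (u : ℝ → EuclideanSpace ℝ (Fin n))
    {j : ℤ} {x : ℝ} (hx : x ∈ Ico ((j : ℝ) * ε) ((j + 1) * ε)) :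
    cellAvg ε u x = ε⁻¹ • ∫ y in ((j : ℝ) * ε)..((j + 1) * ε), u y := by
  have hj : ⌊x / ε⌋ = j :=
    Int.floor_eq_iff.2 ⟨(le_div_iff₀ hε).2 hx.1, (div_lt_iff₀ hε).2 hx.2⟩
  rw [cellAvg, hj]

/-- for a convex Lipschitz entropy `η`, an integrable BV function `u`
and a nonnegative `C¹` compactly supported test function `φ`,
`∫ (η(u) − η(P_ε u)) φ ≥ − L_η ε² ‖φ'‖_{L∞} · Tot.Var.{u}`. -/
theorem stmt10 {n : ℕ} (η : EuclideanSpace ℝ (Fin n) → ℝ) (Lη : ℝ≥0)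
    (hconv : ConvexOn ℝ Set.univ η) (hLip : LipschitzWith Lη η)
    (ε : ℝ) (hε : 0 < ε) (u : ℝ → EuclideanSpace ℝ (Fin n))
    (hu : Integrable u) (hBV : BoundedVariationOn u Set.univ)
    (φ : ℝ → ℝ) (hφ : ContDiff ℝ 1 φ) (hsupp : HasCompactSupport φ)
    (hpos : ∀ x, 0 ≤ φ x)
    (N : ℝ) (hN : ∀ x, |deriv φ x| ≤ N) :
    (∫ x, (η (u x) - η (cellAvg ε u x)) * φ x) ≥
      -((Lη : ℝ) * ε ^ 2 * N * (eVariationOn u Set.univ).toReal) := by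
  obtain ⟨R, hR⟩ : ∃ R, ∀ x, φ x ≠ 0 → |x| ≤ R := by
    obtain ⟨R, hR⟩ := hsupp.isCompact.isBounded.exists_norm_le
    exact ⟨R, fun x hx => hR x (subset_tsupport φ hx)⟩
  obtain ⟨M, hM⟩ := exists_nat_gt (R / ε)
  rw [div_lt_iff₀ hε] at hM
  let c : ℕ → ℝ := fun k => (((k : ℤ) - M : ℤ) : ℝ) * ε
  have hc_succ : ∀ k, c (k + 1) = ((((k : ℤ) - M : ℤ) : ℝ) + 1) * ε := fun k => by
    simp only [c]; push_cast; ring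
  have hc_sub : ∀ k, c (k + 1) - c k = ε := fun k => by rw [hc_succ]; ring
  have hc_lt : ∀ k, c k < c (k + 1) := fun k => by linarith [hc_sub k]
  have hc_mono : Monotone c := monotone_nat_of_le_succ fun k => (hc_lt k).le
  let m : ℕ → EuclideanSpace ℝ (Fin n) := fun k =>
    (c (k + 1) - c k)⁻¹ • ∫ y in c k..c (k + 1), u y
  have hcell : ∀ k, EqOn (fun x => (η (u x) - η (m k)) * φ x)
      (fun x => (η (u x) - η (cellAvg ε u x)) * φ x) (uIoo (c k) (c (k + 1))) := by
    intro k x hx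
    rw [uIoo_of_lt (hc_lt k), hc_succ] at hx
    have hm : m k = cellAvg ε u x := by
      rw [cellAvg_eq_of_mem_Ico hε u (Ioo_subset_Ico_self hx), ← hc_succ]
      simp only [m, hc_sub]
      rfl
    simp only [hm]
  have hint : ∀ k, IntervalIntegrable (fun x => (η (u x) - η (cellAvg ε u x)) * φ x) volume
      (c k) (c (k + 1)) := fun k =>
    ((hLip.intervalIntegrable_comp_sub_const hu.intervalIntegrable (m k)).mul_continuousOn
      hφ.continuous.continuousOn).congr_uIoo (hcell k)
  have hsub : Function.support (fun x => (η (u x) - η (cellAvg ε u x)) * φ x) ⊆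
      Ioc (c 0) (c (2 * M)) := by
    intro x hx
    have hxR := abs_le.1 (hR x (right_ne_zero_of_mul hx))
    simp only [c, mem_Ioc]
    push_cast
    constructor <;> linarith
  have hBVk : ∀ k, BoundedVariationOn u (Icc (c k) (c (k + 1))) := fun k =>
    hBV.mono (subset_univ _)
  have hV : ∑ k ∈ Finset.range (2 * M), (eVariationOn u (Icc (c k) (c (k + 1)))).toReal ≤
      (eVariationOn u univ).toReal := by
    rw [← ENNReal.toReal_sum fun k _ => hBVk k, eVariationOn.sum' u hc_mono]
    exact ENNReal.toReal_mono hBV (eVariationOn.mono u (subset_univ _))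
  have hN0 : 0 ≤ N := (abs_nonneg _).trans (hN 0)
  rw [ge_iff_le, ← intervalIntegral.integral_eq_integral_of_support_subset hsub,
    ← intervalIntegral.sum_integral_adjacent_intervals fun k _ => hint k]
  calc -((Lη : ℝ) * ε ^ 2 * N * (eVariationOn u univ).toReal)
      ≤ ∑ k ∈ Finset.range (2 * M),
          -((Lη : ℝ) * ε ^ 2 * N * (eVariationOn u (Icc (c k) (c (k + 1)))).toReal) := by
        rw [Finset.sum_neg_distrib, ← Finset.mul_sum]
        exact neg_le_neg (mul_le_mul_of_nonneg_left hV (by positivity))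
    _ ≤ _ := Finset.sum_le_sum fun k _ => by
        rw [← intervalIntegral.integral_congr_uIoo (hcell k)]
        simpa only [hc_sub, m] using hconv.neg_le_integral_comp_sub_mean_mul hLip (hc_lt k)
          hu.intervalIntegrable (hBVk k) (hφ.differentiable one_ne_zero) (hpos _) hN
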